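/- arXiv:2407.12171 — 7 statements merged into one kernel-verified Lean document; each statement's English description precedes it below -/
import Mathlib

section
/- Let 𝓕₀ ⊆ ([n] choose k) with |𝓕₀| = m, and assume ω(𝓕) ≤ ω(𝓕₀) for every 𝓕 ⊆ ([n] choose k) with |𝓕| = m. Then for every 𝓖 ⊆ ([n] choose k) with |𝓖| = C(n,k) − m, one has ω(𝓖) ≤ ω(([n] choose k) \ 𝓕₀). -/
open Finset

/-- `ω(𝓕)`: the sum of `|A ∩ B|` over unordered pairs of distinct members of `𝓕`. -/
def omegaF (F : Finset (Finset ℕ)) : ℕ :=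
  ∑ p ∈ F.sym2.filter (fun p => ¬ p.IsDiag),
    Sym2.lift ⟨fun A B => (A ∩ B).card, fun A B => by simp [Finset.inter_comm]⟩ p

/-- `ω(𝓕, 𝓖)`: the sum of `|A ∩ B|` over all ordered pairs `(A, B) ∈ 𝓕 × 𝓖`. -/
def omegaPair (F G : Finset (Finset ℕ)) : ℕ :=
  ∑ A ∈ F, ∑ B ∈ G, (A ∩ B).card

/-- `ω(F, 𝓕)`: the sum of `|F ∩ A|` over all `A ∈ 𝓕`. -/
def omegaSet (F : Finset ℕ) (G : Finset (Finset ℕ)) : ℕ :=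
  ∑ A ∈ G, (F ∩ A).card

/-- `A` precedes `B` in the lexicographic ordering: `min (A \ B) < min (B \ A)`. -/
def lexLT (A B : Finset ℕ) : Prop :=
  (A \ B).min < (B \ A).min

/-- `L` consists of the first `m` sets of `([n] choose k)` in the lexicographic
ordering: it is an `m`-element subfamily all of whose members lexicographically
precede all non-members. -/
def IsInitSeg (n k m : ℕ) (L : Finset (Finset ℕ)) : Prop :=
  L ⊆ (Finset.Icc 1 n).powersetCard k ∧ L.card = m ∧
    ∀ A ∈ L, ∀ B ∈ (Finset.Icc 1 n).powersetCard k, B ∉ L → lexLT A B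

/-- The `(n,k)`-cascade end of `m` is at most `r`: writing
`C(n,k) - m = C(n-r₁,k) + C(n-r₂,k-1) + ⋯ + C(n-rₛ,k-s+1)` in `k`-cascade form
with `1 ≤ r₁ < ⋯ < rₛ ≤ n-1`, one has `rₛ ≤ r`. -/
def CascadeEndLe (n k m r : ℕ) : Prop :=
  ∃ (s : ℕ) (f : Fin (s + 1) → ℕ),
    s + 1 ≤ k ∧ StrictMono f ∧ 1 ≤ f 0 ∧ f (Fin.last s) ≤ n - 1 ∧
    (∀ i : Fin (s + 1), k - (i : ℕ) ≤ n - f i) ∧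
    f (Fin.last s) ≤ r ∧
    n.choose k - m = ∑ i : Fin (s + 1), (n - f i).choose (k - (i : ℕ))

theorem omegaF_insert_aux (a : Finset ℕ) (F : Finset (Finset ℕ)) (ha : a ∉ F) :
    omegaF (insert a F) = omegaSet a F + omegaF F := by
  have h1 : (insert a F).sym2.filter (fun p => ¬ p.IsDiag)
      = F.image (fun b => s(a, b)) ∪ F.sym2.filter (fun p => ¬ p.IsDiag) := by
    ext p
    induction p using Sym2.ind with
    | _ x y =>
      simp only [mem_filter, mk_mem_sym2_iff, mem_insert, Sym2.mk_isDiag_iff, mem_union, mem_image,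
        Sym2.eq_iff]
      constructor
      · rintro ⟨⟨rfl | hx, rfl | hy⟩, hne⟩
        · exact absurd rfl hne
        · exact Or.inl ⟨y, hy, Or.inl ⟨rfl, rfl⟩⟩
        · exact Or.inl ⟨x, hx, Or.inr ⟨rfl, rfl⟩⟩
        · exact Or.inr ⟨⟨hx, hy⟩, hne⟩
      · rintro (⟨b, hb, ⟨rfl, rfl⟩ | ⟨rfl, rfl⟩⟩ | ⟨⟨hx, hy⟩, hne⟩)
        · exact ⟨⟨Or.inl rfl, Or.inr hb⟩, fun h => ha (h ▸ hb)⟩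
        · exact ⟨⟨Or.inr hb, Or.inl rfl⟩, fun h => ha (h ▸ hb)⟩
        · exact ⟨⟨Or.inr hx, Or.inr hy⟩, hne⟩
  have hd : Disjoint (F.image (fun b => s(a, b))) (F.sym2.filter (fun p => ¬ p.IsDiag)) := by
    rw [Finset.disjoint_left]
    intro p hp hq
    obtain ⟨b, hb, rfl⟩ := mem_image.1 hp
    exact ha (mk_mem_sym2_iff.1 (mem_filter.1 hq).1).1
  unfold omegaF omegaSet
  rw [h1, sum_union hd, sum_image]
  · simp
  · intro x _ y _ h
    exact Sym2.congr_right.1 h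

theorem omegaPair_self_aux (F : Finset (Finset ℕ)) :
    omegaPair F F = 2 * omegaF F + ∑ A ∈ F, A.card := by
  induction F using Finset.induction_on with
  | empty => simp [omegaPair, omegaF]
  | insert a F ha ih =>
    rw [omegaF_insert_aux a F ha, sum_insert ha]
    unfold omegaPair at ih ⊢
    simp only [sum_insert ha, sum_add_distrib, inter_self]
    have : ∑ A ∈ F, (A ∩ a).card = omegaSet a F :=
      sum_congr rfl fun A _ => by rw [inter_comm]
    rw [this, ih]
    change a.card + omegaSet a F + _ = _
    ring

theorem omegaSet_const_aux (n k : ℕ) (A : Finset ℕ) (hA : A ∈ (Finset.Icc 1 n).powersetCard k) :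
    omegaSet A ((Finset.Icc 1 n).powersetCard k) = k * (n.choose k - (n - 1).choose k) := by
  obtain ⟨hs, hc⟩ := mem_powersetCard.1 hA
  have h1 : ∀ x ∈ A, (((Finset.Icc 1 n).powersetCard k).filter (fun B => x ∈ B)).card
      = n.choose k - (n - 1).choose k := by
    intro x hx
    have h2 : ((Finset.Icc 1 n).powersetCard k).filter (fun B => ¬ x ∈ B)
        = ((Finset.Icc 1 n).erase x).powersetCard k := by
      ext B
      simp only [mem_filter, mem_powersetCard, subset_erase]
      tauto
    have h3 := card_filter_add_card_filter_not (s := (Finset.Icc 1 n).powersetCard k)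
      (fun B => x ∈ B)
    rw [h2, card_powersetCard, card_powersetCard, card_erase_of_mem (hs hx)] at h3
    simp only [Nat.card_Icc, Nat.add_sub_cancel] at h3
    omega
  unfold omegaSet
  calc _ = ∑ B ∈ (Finset.Icc 1 n).powersetCard k, ∑ x ∈ A, if x ∈ B then 1 else 0 := by
        refine sum_congr rfl fun B _ => ?_
        rw [← filter_mem_eq_inter, card_filter]
    _ = ∑ x ∈ A, (((Finset.Icc 1 n).powersetCard k).filter (fun B => x ∈ B)).card := by
        rw [sum_comm]
        simp only [card_filter]
    _ = _ := by rw [sum_congr rfl h1, sum_const, hc, smul_eq_mul]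

theorem omegaF_compl_aux (n k : ℕ) (F : Finset (Finset ℕ))
    (hF : F ⊆ (Finset.Icc 1 n).powersetCard k) :
    2 * omegaF ((Finset.Icc 1 n).powersetCard k \ F) + k * (n.choose k - F.card)
      + 2 * (F.card * (k * (n.choose k - (n - 1).choose k)))
    = omegaPair ((Finset.Icc 1 n).powersetCard k) ((Finset.Icc 1 n).powersetCard k)
      + (2 * omegaF F + k * F.card) := by
  set U := (Finset.Icc 1 n).powersetCard k with hU
  have hsum : ∀ H ⊆ U, ∑ A ∈ H, A.card = k * H.card := by
    intro H hH
    rw [sum_congr rfl fun A hA => (mem_powersetCard.1 (hH hA)).2, sum_const, smul_eq_mul, mul_comm]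
  have hcard : (U \ F).card = n.choose k - F.card := by
    rw [card_sdiff_of_subset hF, hU, card_powersetCard]; simp
  have e1 := omegaPair_self_aux (U \ F)
  have e2 := omegaPair_self_aux F
  rw [hsum _ sdiff_subset, hcard] at e1
  rw [hsum _ hF] at e2
  have e3 : omegaPair F U = F.card * (k * (n.choose k - (n - 1).choose k)) := by
    change ∑ A ∈ F, omegaSet A U = _
    rw [sum_congr rfl fun A hA => omegaSet_const_aux n k A (hF hA), sum_const, smul_eq_mul]
  have spl : ∀ H, omegaPair H U = omegaPair H (U \ F) + omegaPair H F := by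
    intro H
    unfold omegaPair
    rw [← sum_add_distrib]
    exact sum_congr rfl fun A _ => (sum_sdiff hF).symm
  have spr : omegaPair U U = omegaPair (U \ F) U + omegaPair F U := (sum_sdiff hF).symm
  have cm : omegaPair (U \ F) F = omegaPair F (U \ F) := by
    unfold omegaPair
    rw [sum_comm]
    simp only [inter_comm]
  have s1 := spl (U \ F)
  have s2 := spl F
  rw [← e1, ← e2, ← e3]
  omega

theorem complement_of_extremal_is_extremal
    (n k m : ℕ) (F0 : Finset (Finset ℕ))
    (hF0 : F0 ⊆ (Finset.Icc 1 n).powersetCard k) (hF0card : F0.card = m)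
    (hext : ∀ F ⊆ (Finset.Icc 1 n).powersetCard k, F.card = m → omegaF F ≤ omegaF F0)
    (G : Finset (Finset ℕ)) (hG : G ⊆ (Finset.Icc 1 n).powersetCard k)
    (hGcard : G.card = n.choose k - m) :
    omegaF G ≤ omegaF ((Finset.Icc 1 n).powersetCard k \ F0) := by
  have hUcard : ((Finset.Icc 1 n).powersetCard k).card = n.choose k := by
    rw [card_powersetCard]; simp
  have hm : m ≤ n.choose k := by
    rw [← hF0card, ← hUcard]; exact card_le_card hF0
  have hc : ((Finset.Icc 1 n).powersetCard k \ G).card = m := by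
    rw [card_sdiff_of_subset hG, hUcard]; omega
  have h := hext _ sdiff_subset hc
  have e0 := omegaF_compl_aux n k F0 hF0
  have e1 := omegaF_compl_aux n k ((Finset.Icc 1 n).powersetCard k \ G) sdiff_subset
  rw [hc, Finset.sdiff_sdiff_eq_self hG] at e1
  rw [hF0card] at e0
  omega
end

section
/- Let n, k, r be positive integers with k ≤ n and 1 ≤ r ≤ n−1, and let m satisfy C(n,k) − C(n−r+1,k) < m ≤ C(n,k) − C(n−r,k). Then ω(L_{n,k}^m) ≥ m²/(2r) − k·m/2. -/
open Finset

lemma two_mul_omegaF_add (F : Finset (Finset ℕ)) :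
    2 * omegaF F + ∑ A ∈ F, A.card = ∑ A ∈ F, ∑ B ∈ F, (A ∩ B).card := by
  induction F using Finset.cons_induction with
  | empty => simp [omegaF]
  | cons a s ha ih =>
    have h1 : omegaF (s.cons a ha) = (∑ B ∈ s, (a ∩ B).card) + omegaF s := by
      unfold omegaF
      rw [Finset.sum_filter, Finset.sum_filter, Finset.sym2_cons, Finset.sum_disjUnion,
        Finset.sum_map, Finset.sum_cons]
      congr 1
      simp only [Sym2.mkEmbedding_apply, Sym2.mk_isDiag_iff, not_true_eq_false, if_false, zero_add]
      refine Finset.sum_congr rfl fun B hB => ?_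
      have : a ≠ B := by rintro rfl; exact ha hB
      simp [this]
    rw [h1]
    simp only [Finset.sum_cons, Finset.sum_add_distrib, Finset.inter_self]
    have h2 : ∑ A ∈ s, (A ∩ a).card = ∑ A ∈ s, (a ∩ A).card :=
      Finset.sum_congr rfl fun A _ => by rw [Finset.inter_comm]
    rw [h2, ← ih]
    ring

lemma initSeg_meets (n k r m : ℕ) (hrn : r ≤ n)
    (hm2 : m ≤ n.choose k - (n - r).choose k)
    (L : Finset (Finset ℕ)) (hL : IsInitSeg n k m L) (A : Finset ℕ) (hA : A ∈ L) :
    (A ∩ Finset.Icc 1 r).Nonempty := by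
  obtain ⟨hsub, hcard, hlex⟩ := hL
  by_contra hne
  rw [Finset.not_nonempty_iff_eq_empty] at hne
  set P := (Finset.Icc 1 n).powersetCard k
  set Q := (Finset.Icc (r + 1) n).powersetCard k
  have hQP : Q ⊆ P := Finset.powersetCard_mono (Finset.Icc_subset_Icc (by omega) le_rfl)
  have hPQ : (P \ Q).card = n.choose k - (n - r).choose k := by
    rw [Finset.card_sdiff_of_subset hQP]
    simp [P, Q]
  have hAr : ∀ x ∈ A, x ∉ Finset.Icc 1 r := fun x hx hx' => by
    have : x ∈ A ∩ Finset.Icc 1 r := Finset.mem_inter.2 ⟨hx, hx'⟩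
    rw [hne] at this
    simp at this
  have hAP := Finset.mem_powersetCard.1 (hsub hA)
  have hAQ : A ∈ Q := by
    refine Finset.mem_powersetCard.2 ⟨fun x hx => ?_, hAP.2⟩
    have h1 := Finset.mem_Icc.1 (hAP.1 hx)
    have h2 := hAr x hx
    rw [Finset.mem_Icc] at h2 ⊢
    omega
  have hss : P \ Q ⊆ L := by
    intro B hB
    obtain ⟨hBP, hBQ⟩ := Finset.mem_sdiff.1 hB
    by_contra hBL
    have hlt : (A \ B).min < (B \ A).min := hlex A hA B hBP hBL
    have hBP' := Finset.mem_powersetCard.1 hBP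
    have : ∃ x ∈ B, x ≤ r := by
      by_contra! hcon
      refine hBQ (Finset.mem_powersetCard.2 ⟨fun x hx => ?_, hBP'.2⟩)
      have h1 := Finset.mem_Icc.1 (hBP'.1 hx)
      have h2 := hcon x hx
      rw [Finset.mem_Icc]
      omega
    obtain ⟨x, hxB, hxr⟩ := this
    have hx1 := Finset.mem_Icc.1 (hBP'.1 hxB)
    have hxA : x ∉ A := fun h => hAr x h (Finset.mem_Icc.2 ⟨hx1.1, hxr⟩)
    have hle : (B \ A).min ≤ (x : WithTop ℕ) := Finset.min_le (Finset.mem_sdiff.2 ⟨hxB, hxA⟩)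
    have hge : (x : WithTop ℕ) ≤ (A \ B).min := by
      refine Finset.le_min fun y hy => ?_
      have h1 := (Finset.mem_Icc.1 ((Finset.mem_powersetCard.1 hAQ).1 (Finset.mem_sdiff.1 hy).1)).1
      have h3 : x ≤ y := by omega
      exact WithTop.coe_le_coe.2 h3
    exact absurd (hlt.trans_le (hle.trans hge)) (lt_irrefl _)
  have hins : insert A (P \ Q) ⊆ L := Finset.insert_subset hA hss
  have := Finset.card_le_card hins
  rw [Finset.card_insert_of_notMem (by simp [hAQ]), hPQ, hcard] at this
  omega

theorem omega_initSeg_lower_bound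
    (n k r m : ℕ) (hn : 0 < n) (hk : 0 < k) (hr : 0 < r)
    (hkn : k ≤ n) (hrn : r ≤ n - 1)
    (hm1 : n.choose k - (n - r + 1).choose k < m)
    (hm2 : m ≤ n.choose k - (n - r).choose k)
    (L : Finset (Finset ℕ)) (hL : IsInitSeg n k m L) :
    (m : ℝ) ^ 2 / (2 * r) - (k : ℝ) * m / 2 ≤ (omegaF L : ℝ) := by
  have hmeet := initSeg_meets n k r m (by omega) hm2 L hL
  obtain ⟨hsub, hcard, -⟩ := hL
  have h2 := two_mul_omegaF_add L
  have hsum : ∑ A ∈ L, A.card = m * k := by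
    rw [Finset.sum_const_nat (fun A hA => (Finset.mem_powersetCard.1 (hsub hA)).2), hcard]
  rw [hsum] at h2
  let d : ℕ → ℕ := fun i => ∑ A ∈ L, if i ∈ A then 1 else 0
  have hd1 : m ≤ ∑ i ∈ Finset.Icc 1 r, d i := by
    simp only [d]
    rw [Finset.sum_comm, ← hcard, Finset.card_eq_sum_ones]
    refine Finset.sum_le_sum fun A hA => ?_
    rw [← Finset.card_filter, Finset.one_le_card]
    obtain ⟨x, hx⟩ := hmeet A hA
    rw [Finset.mem_inter] at hx
    exact ⟨x, Finset.mem_filter.2 ⟨hx.2, hx.1⟩⟩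
  have hd2 : ∑ i ∈ Finset.Icc 1 r, d i ^ 2 ≤ ∑ A ∈ L, ∑ B ∈ L, (A ∩ B).card := by
    have : ∀ i, d i ^ 2 = ∑ A ∈ L, ∑ B ∈ L, if i ∈ A ∩ B then 1 else 0 := by
      intro i
      simp only [d, sq, Finset.sum_mul_sum]
      refine Finset.sum_congr rfl fun A _ => Finset.sum_congr rfl fun B _ => ?_
      by_cases h1 : i ∈ A <;> by_cases h2 : i ∈ B <;> simp [h1, h2]
    simp only [this]
    rw [Finset.sum_comm]
    refine Finset.sum_le_sum fun A _ => ?_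
    rw [Finset.sum_comm]
    refine Finset.sum_le_sum fun B _ => ?_
    rw [← Finset.card_filter]
    exact Finset.card_le_card fun x hx => (Finset.mem_filter.1 hx).2
  have hcs : (∑ i ∈ Finset.Icc 1 r, (d i : ℝ)) ^ 2 ≤ r * ∑ i ∈ Finset.Icc 1 r, (d i : ℝ) ^ 2 := by
    have := sq_sum_le_card_mul_sum_sq (s := Finset.Icc 1 r) (f := fun i => (d i : ℝ))
    simpa using this
  rw [← h2] at hd2
  have hd1' : (m : ℝ) ≤ ∑ i ∈ Finset.Icc 1 r, (d i : ℝ) := by exact_mod_cast hd1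
  have hd2' : ∑ i ∈ Finset.Icc 1 r, (d i : ℝ) ^ 2 ≤ 2 * omegaF L + m * k := by exact_mod_cast hd2
  have hr' : (0 : ℝ) < r := by exact_mod_cast hr
  have hmm : (m : ℝ) ^ 2 ≤ r * (2 * omegaF L + m * k) :=
    (pow_le_pow_left₀ (by positivity) hd1' 2).trans
      (hcs.trans (mul_le_mul_of_nonneg_left hd2' hr'.le))
  have : (m : ℝ) ^ 2 / (2 * r) ≤ (2 * omegaF L + m * k) / 2 := by
    rw [div_le_div_iff₀ (by positivity) (by norm_num)]
    nlinarith
  linarith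
end

section
/- Let n, k, r, m be positive integers with r ≥ 2, n > 36k(2k+1)(k+r)r and m > C(n,k) − C(n−r+1,k). Then m ≥ (r−1)·C(n−1,k−1) − C(r−1,2)·C(n−2,k−2), and moreover m ≥ (r·n/(3k))·C(n−2,k−2). -/
open Finset

theorem aux_one (N K s : ℕ) (h : s ≤ N + 1) :
    (N + 1).choose (K + 1) ≤ (N + 1 - s).choose (K + 1) + s * N.choose K := by
  induction s with
  | zero => simp
  | succ s ih =>
    have h1 := ih (by omega)
    have h2 : N + 1 - s = (N + 1 - (s + 1)) + 1 := by omega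
    rw [h2, Nat.choose_succ_succ' (N + 1 - (s + 1)) K] at h1
    have h3 : (N + 1 - (s + 1)).choose K ≤ N.choose K := Nat.choose_le_choose K (by omega)
    have : (s + 1) * N.choose K = s * N.choose K + N.choose K := by ring
    omega

theorem aux_two (N K s : ℕ) (h : s ≤ N + 2) :
    s * (N + 1).choose (K + 1) + (N + 2 - s).choose (K + 2)
      ≤ (N + 2).choose (K + 2) + s.choose 2 * N.choose K := by
  induction s with
  | zero => simp
  | succ s ih =>
    have h1 := ih (by omega)
    have h2 : N + 2 - s = (N + 2 - (s + 1)) + 1 := by omega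
    rw [h2, Nat.choose_succ_succ' (N + 2 - (s + 1)) (K + 1)] at h1
    have h3 := aux_one N K s (by omega)
    have h4 : N + 1 - s = N + 2 - (s + 1) := by omega
    rw [h4] at h3
    have h5 : (s + 1).choose 2 = s + s.choose 2 := by
      rw [Nat.choose_succ_succ' s 1, Nat.choose_one_right]
    rw [h5, add_mul, add_mul, one_mul]
    have h6 : K + 1 + 1 = K + 2 := rfl
    rw [h6] at h1
    omega

theorem m_lower_bound
    (n k r m : ℕ) (hr : 2 ≤ r) (hk : 0 < k) (hn : 0 < n) (hm : 0 < m)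
    (hbig : 36 * k * (2 * k + 1) * (k + r) * r < n)
    (hm1 : n.choose k - (n - r + 1).choose k < m) :
    ((r : ℚ) - 1) * ((n - 1).choose (k - 1) : ℚ)
        - ((r - 1).choose 2 : ℚ) * (if k < 2 then (0 : ℚ) else ((n - 2).choose (k - 2) : ℚ))
      ≤ (m : ℚ) ∧
    (r : ℚ) * (n : ℚ) / (3 * (k : ℚ))
        * (if k < 2 then (0 : ℚ) else ((n - 2).choose (k - 2) : ℚ))
      ≤ (m : ℚ) := by
  have hkn : 36 * k * r ≤ n := by
    have : 36 * k * r * 1 ≤ 36 * k * r * ((2 * k + 1) * (k + r)) :=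
      Nat.mul_le_mul_left _ (Nat.mul_pos (by omega) (by omega))
    nlinarith
  have hkr : k ≤ k * r := Nat.le_mul_of_pos_right _ (by omega)
  have hrk : r ≤ k * r := Nat.le_mul_of_pos_left _ hk
  have hkn' : 36 * (k * r) ≤ n := by rw [← mul_assoc]; exact hkn
  obtain ⟨s, rfl⟩ : ∃ s, r = s + 1 := ⟨r - 1, by omega⟩
  have hs : n - (s + 1) + 1 = n - s := by omega
  rw [hs] at hm1
  by_cases hk2 : k < 2
  · obtain rfl : k = 1 := by omega
    simp only [Nat.choose_one_right] at hm1
    have : s ≤ m := by omega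
    have h' : (s : ℚ) ≤ m := by exact_mod_cast this
    simp
    exact this
  · obtain ⟨K, rfl⟩ : ∃ K, k = K + 2 := ⟨k - 2, by omega⟩
    obtain ⟨N, rfl⟩ : ∃ N, n = N + 2 := ⟨n - 2, by omega⟩
    have h2 := aux_two N K s (by omega)
    have key : s * (N + 1).choose (K + 1) ≤ m + s.choose 2 * N.choose K := by omega
    have e1 : N + 2 - 1 = N + 1 := rfl
    have e2 : K + 2 - 1 = K + 1 := rfl
    simp only [if_neg hk2, e1, e2, Nat.add_sub_cancel]
    have keyq : (s : ℚ) * ((N + 1).choose (K + 1) : ℚ) ≤ m + (s.choose 2 : ℚ) * (N.choose K : ℚ) := by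
      exact_mod_cast key
    constructor
    · push_cast
      linarith
    · have hc : ((N : ℚ) + 1) * (N.choose K : ℚ) = ((N + 1).choose (K + 1) : ℚ) * (K + 1) := by
        exact_mod_cast Nat.add_one_mul_choose_eq N K
      rw [Nat.cast_choose_two] at keyq
      have hKN : ((K : ℚ) + 2) * (s + 1) * 36 ≤ N + 2 := by
        have : (K + 2) * (s + 1) * 36 ≤ N + 2 := by linarith
        exact_mod_cast this
      have hs1 : (1 : ℚ) ≤ s := by
        have : 1 ≤ s := by omega
        exact_mod_cast this
      have hK0 : (0 : ℚ) ≤ K := Nat.cast_nonneg _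
      have hB : (0 : ℚ) ≤ (N.choose K : ℚ) := Nat.cast_nonneg _
      generalize ((N + 1).choose (K + 1) : ℚ) = A at *
      generalize (N.choose K : ℚ) = B at *
      push_cast
      generalize (N : ℚ) = x at *
      generalize (K : ℚ) = y at *
      generalize (s : ℚ) = t at *
      have hA : A = (x + 1) / (y + 1) * B := by
        field_simp
        linarith
      have hxy : y ≤ x := by nlinarith
      have hf : (x + 2) / (y + 2) ≤ (x + 1) / (y + 1) := by
        rw [div_le_div_iff₀ (by linarith) (by linarith)]
        nlinarith
      have hg : (t + 1) * 36 ≤ (x + 2) / (y + 2) := by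
        rw [le_div_iff₀ (by linarith)]
        nlinarith
      have hd : (t + 1) * (x + 2) / (3 * (y + 2)) = (t + 1) / 3 * ((x + 2) / (y + 2)) := by
        field_simp
      rw [hd]
      rw [hA] at keyq
      generalize (x + 2) / (y + 2) = u at *
      generalize (x + 1) / (y + 1) = v at *
      have hfin : (t + 1) / 3 * u ≤ t * v - t * (t - 1) / 2 := by
        have h1 : t * u ≤ t * v := mul_le_mul_of_nonneg_left hf (by linarith)
        nlinarith [mul_nonneg (by linarith : (0:ℚ) ≤ t) (by linarith : (0:ℚ) ≤ u - (t + 1) * 36),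
          mul_nonneg (by linarith : (0:ℚ) ≤ t - 1) (by linarith : (0:ℚ) ≤ u)]
      have := mul_le_mul_of_nonneg_right hfin hB
      linarith
end

section
/- Let n, k, r, m be positive integers with r ≥ 2, n > 36k(2k+1)(k+r)r and C(n,k) − C(n−r+1,k) < m ≤ C(n,k) − C(n−r,k). Then for every family 𝓕 ⊆ ([n] choose k) with |𝓕| = m, the set X₀ := {x ∈ [n] : |𝓕(x)| ≥ m/(3kr)} satisfies |X₀| < 6kr. -/
open Finset

lemma hdv_chooseA (N a j : ℕ) (h : j ≤ N) :
    N.choose (a + 1) ≤ (N - j).choose (a + 1) + j * (N - 1).choose a := by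
  induction j with
  | zero => simp
  | succ j ih =>
    have ih := ih (by omega)
    have e : N - j = (N - (j + 1)) + 1 := by omega
    have p := Nat.choose_succ_succ (N - (j + 1)) a
    rw [← Nat.succ_eq_add_one] at e
    rw [← e] at p
    have q : (N - (j + 1)).choose a ≤ (N - 1).choose a := Nat.choose_le_choose a (by omega)
    simp only [Nat.succ_eq_add_one] at p
    rw [add_mul]
    omega

lemma hdv_chooseB (n a s : ℕ) (h : s ≤ n) :
    (n - s).choose (a + 1) + s * (n - s).choose a ≤ n.choose (a + 1) := by
  have key : ∀ M s : ℕ, M.choose (a + 1) + s * M.choose a ≤ (M + s).choose (a + 1) := by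
    intro M s
    induction s with
    | zero => simp
    | succ s ih =>
      have p := Nat.choose_succ_succ (M + s) a
      have q : M.choose a ≤ (M + s).choose a := Nat.choose_le_choose a (by omega)
      simp only [Nat.succ_eq_add_one] at p
      rw [add_mul, ← add_assoc M s 1]
      omega
  have := key (n - s) s
  rwa [Nat.sub_add_cancel h] at this

lemma hdv_superset (S P : Finset ℕ) (k : ℕ) (hP : P ⊆ S) :
    (((S.powersetCard k).filter (fun A => P ⊆ A)).card) ≤
      (S.card - P.card).choose (k - P.card) := by
  rw [← Finset.card_sdiff_of_subset hP, ← Finset.card_powersetCard]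
  apply Finset.card_le_card_of_injOn (fun A => A \ P)
  · intro A hA
    simp only [Finset.coe_filter, Set.mem_ofPred_eq, Finset.mem_powersetCard] at hA
    simp only [Finset.mem_coe, Finset.mem_powersetCard]
    refine ⟨Finset.sdiff_subset_sdiff hA.1.1 (le_refl _), ?_⟩
    rw [Finset.card_sdiff_of_subset hA.2, hA.1.2]
  · intro A hA B hB hAB
    simp only [Finset.coe_filter, Set.mem_ofPred_eq, Finset.mem_powersetCard] at hA hB
    simp only at hAB
    rw [← Finset.sdiff_union_of_subset hA.2, ← Finset.sdiff_union_of_subset hB.2, hAB]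

lemma hdv_le_choose (c : ℕ) : c ≤ 1 + c.choose 2 := by
  cases c with
  | zero => simp
  | succ c =>
    have p := Nat.choose_succ_succ c 1
    simp at p
    omega

lemma hdv_pairs (F : Finset (Finset ℕ)) (Y : Finset ℕ) :
    ∑ x ∈ Y, (F.filter (fun A => x ∈ A)).card ≤
      F.card + ∑ P ∈ Y.powersetCard 2, (F.filter (fun A => P ⊆ A)).card := by
  have h1 := Finset.sum_card_bipartiteAbove_eq_sum_card_bipartiteBelow
    (s := Y) (t := F) (fun x A => x ∈ A)
  have h2 := Finset.sum_card_bipartiteAbove_eq_sum_card_bipartiteBelow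
    (s := Y.powersetCard 2) (t := F) (fun P A => P ⊆ A)
  simp only [Finset.bipartiteAbove, Finset.bipartiteBelow] at h1 h2
  rw [h1, h2, Finset.card_eq_sum_ones, ← Finset.sum_add_distrib]
  apply Finset.sum_le_sum
  intro A _
  have e : (Y.powersetCard 2).filter (fun P => P ⊆ A) =
      (Y.filter (fun x => x ∈ A)).powersetCard 2 := by
    ext P
    simp only [Finset.mem_filter, Finset.mem_powersetCard, Finset.subset_iff]
    grind
  rw [e, Finset.card_powersetCard]
  exact hdv_le_choose _

theorem high_degree_vertices_few
    (n k r m : ℕ) (hr : 2 ≤ r) (hk : 0 < k) (hn : 0 < n) (hm : 0 < m)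
    (hbig : 36 * k * (2 * k + 1) * (k + r) * r < n)
    (hm1 : n.choose k - (n - r + 1).choose k < m)
    (hm2 : m ≤ n.choose k - (n - r).choose k)
    (F : Finset (Finset ℕ)) (hFsub : F ⊆ (Finset.Icc 1 n).powersetCard k)
    (hFcard : F.card = m) :
    ((Finset.Icc 1 n).filter
      (fun x => (m : ℚ) / (3 * (k : ℚ) * (r : ℚ)) ≤ ((F.filter (fun A => x ∈ A)).card : ℚ))).card
      < 6 * k * r := by
  by_contra hcon
  push Not at hcon
  obtain ⟨Y, hYsub, hYcard⟩ := Finset.exists_subset_card_eq hcon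
  have hpairs := hdv_pairs F Y
  have hlow : 2 * m ≤ ∑ x ∈ Y, (F.filter (fun A => x ∈ A)).card := by
    have h : ∑ x ∈ Y, ((m : ℚ) / (3 * (k : ℚ) * (r : ℚ))) ≤
        ∑ x ∈ Y, ((F.filter (fun A => x ∈ A)).card : ℚ) := by
      apply Finset.sum_le_sum
      intro x hx
      exact (Finset.mem_filter.mp (hYsub hx)).2
    rw [Finset.sum_const, hYcard, nsmul_eq_mul] at h
    have hk' : (k : ℚ) ≠ 0 := by positivity
    have hr' : (r : ℚ) ≠ 0 := by
      have : r ≠ 0 := by omega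
      exact_mod_cast this
    have e : ((6 * k * r : ℕ) : ℚ) * ((m : ℚ) / (3 * (k : ℚ) * (r : ℚ))) = 2 * m := by
      push_cast
      field_simp
      norm_num
    rw [e] at h
    exact_mod_cast h
  rw [hFcard] at hpairs
  have hYn : Y ⊆ Finset.Icc 1 n := hYsub.trans (Finset.filter_subset _ _)
  rcases Nat.lt_or_ge k 2 with hk2 | hk2
  · have hz : ∑ P ∈ Y.powersetCard 2, (F.filter (fun A => P ⊆ A)).card = 0 := by
      apply Finset.sum_eq_zero
      intro P hP
      rw [Finset.card_eq_zero, Finset.filter_eq_empty_iff]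
      intro A hA hPA
      have h1 := (Finset.mem_powersetCard.mp (hFsub hA)).2
      have h2 := (Finset.mem_powersetCard.mp hP).2
      have h3 := Finset.card_le_card hPA
      omega
    omega
  obtain ⟨a, rfl⟩ : ∃ a, k = a + 2 := ⟨k - 2, by omega⟩
  obtain ⟨s, rfl⟩ : ∃ s, r = s + 2 := ⟨r - 2, by omega⟩
  have hub : ∑ P ∈ Y.powersetCard 2, (F.filter (fun A => P ⊆ A)).card ≤
      (6 * (a + 2) * (s + 2)).choose 2 * (n - 2).choose a := by
    rw [← hYcard, ← Finset.card_powersetCard, ← smul_eq_mul]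
    apply Finset.sum_le_card_nsmul
    intro P hP
    obtain ⟨hP1, hP2⟩ := Finset.mem_powersetCard.mp hP
    have h := hdv_superset (Finset.Icc 1 n) P (a + 2) (hP1.trans hYn)
    rw [hP2] at h
    simp only [Nat.card_Icc, Nat.add_sub_cancel] at h
    exact (Finset.card_le_card (Finset.filter_subset_filter _ hFsub)).trans h
  have hc2 : 2 * (6 * (a + 2) * (s + 2)).choose 2 ≤ (6 * (a + 2) * (s + 2)) ^ 2 := by
    rw [Nat.choose_two_right]
    have := Nat.mul_div_le ((6 * (a + 2) * (s + 2)) * (6 * (a + 2) * (s + 2) - 1)) 2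
    refine this.trans ?_
    rw [sq]
    exact Nat.mul_le_mul_left _ (Nat.sub_le _ _)
  have hns : s + 2 ≤ n := by
    have h1 : 1 * (s + 2) ≤ 36 * (a + 2) * (2 * (a + 2) + 1) * (a + 2 + (s + 2)) * (s + 2) :=
      Nat.mul_le_mul_right _ (Nat.succ_le_of_lt (by positivity))
    omega
  obtain ⟨N, rfl⟩ : ∃ N, n = N + 2 := ⟨n - 2, by omega⟩
  have hA := hdv_chooseA (N + 1) a s (by omega)
  have hB := hdv_chooseB (N + 2) (a + 1) (s + 1) (by omega)
  have e1 : N + 2 - (s + 2) + 1 = N + 2 - (s + 1) := by omega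
  have e2 : N + 1 - s = N + 2 - (s + 1) := by omega
  have e3 : N + 1 - 1 = N := by omega
  have e4 : N + 2 - 2 = N := by omega
  rw [e1] at hm1
  rw [e2, e3] at hA
  rw [e4] at hub
  have hE : (N + 1) * N.choose a = (N + 1).choose (a + 1) * (a + 1) :=
    Nat.add_one_mul_choose_eq N a
  have hmG : (s + 1) * (N + 2 - (s + 1)).choose (a + 1) < m := by
    have e5 : a + 1 + 1 = a + 2 := rfl
    rw [e5] at hB
    omega
  generalize (N + 2 - (s + 1)).choose (a + 1) = G at *
  generalize (N + 1).choose (a + 1) = E at *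
  generalize N.choose a = D at *
  generalize (6 * (a + 2) * (s + 2)).choose 2 = T at *
  have hmT : m ≤ T * D := by omega
  have hm3 : 2 * m ≤ (6 * (a + 2) * (s + 2)) ^ 2 * D := by
    calc 2 * m ≤ 2 * (T * D) := by omega
      _ = (2 * T) * D := by ring
      _ ≤ _ := Nat.mul_le_mul_right _ hc2
  have h1 : 2 * (s + 1) * E < ((6 * (a + 2) * (s + 2)) ^ 2 + 2 * (s + 1) * s) * D := by
    calc 2 * (s + 1) * E ≤ 2 * (s + 1) * (G + s * D) := Nat.mul_le_mul_left _ hA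
      _ = 2 * ((s + 1) * G) + 2 * (s + 1) * s * D := by ring
      _ < (6 * (a + 2) * (s + 2)) ^ 2 * D + 2 * (s + 1) * s * D := by omega
      _ = _ := by ring
  have h2 : (2 * (s + 1) * (N + 1)) * D <
      ((a + 1) * ((6 * (a + 2) * (s + 2)) ^ 2 + 2 * (s + 1) * s)) * D := by
    calc (2 * (s + 1) * (N + 1)) * D = 2 * (s + 1) * ((N + 1) * D) := by ring
      _ = (a + 1) * (2 * (s + 1) * E) := by rw [hE]; ring
      _ < (a + 1) * (((6 * (a + 2) * (s + 2)) ^ 2 + 2 * (s + 1) * s) * D) :=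
        Nat.mul_lt_mul_of_pos_left h1 (by omega)
      _ = _ := by ring
  have h3 := Nat.lt_of_mul_lt_mul_right h2
  have h4 : 36 * (a + 2) * (2 * (a + 2) + 1) * (a + 2 + (s + 2)) * (s + 2) ≤ N + 1 := by omega
  have h5 := Nat.mul_le_mul_left (2 * (s + 1)) h4
  have h6 : (a + 1) * ((6 * (a + 2) * (s + 2)) ^ 2 + 2 * (s + 1) * s) ≤
      2 * (s + 1) * (36 * (a + 2) * (2 * (a + 2) + 1) * (a + 2 + (s + 2)) * (s + 2)) := by
    zify
    rw [← sub_nonneg]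
    ring_nf
    positivity
  omega
end

section
/- Let n, k, r, m be positive integers with r ≥ 2, n > 36k(2k+1)(k+r)r and C(n,k) − C(n−r+1,k) < m ≤ C(n,k) − C(n−r,k). If 𝓕 ⊆ ([n] choose k) has |𝓕| = m and 𝓕 is extremal (ω(𝓕') ≤ ω(𝓕) for every 𝓕' ⊆ ([n] choose k) with |𝓕'| = m), then there exists x ∈ [n] with |𝓕(x)| > m/(3r). -/
open Finset

/-- degree of `x` in `F` -/
def dg (F : Finset (Finset ℕ)) (x : ℕ) : ℕ := (F.filter (fun A => x ∈ A)).card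

theorem omega_two (F : Finset (Finset ℕ)) :
    2 * omegaF F = ∑ p ∈ F.offDiag, (p.1 ∩ p.2).card := by
  have hmap : ∀ p ∈ F.offDiag, s(p.1, p.2) ∈ F.sym2.filter (fun p => ¬ p.IsDiag) := by
    rintro ⟨a, b⟩ h
    simp only [mem_offDiag] at h
    simp [h]
  rw [← Finset.sum_fiberwise_of_maps_to hmap, omegaF, Finset.mul_sum]
  refine Finset.sum_congr rfl ?_
  intro z
  refine Sym2.inductionOn z ?_
  intro a b hz
  simp only [mem_filter, Finset.mk_mem_sym2_iff, Sym2.isDiag_iff_proj_eq] at hz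
  obtain ⟨⟨ha, hb⟩, hab⟩ := hz
  have h : F.offDiag.filter (fun p => s(p.1, p.2) = s(a, b)) = {(a, b), (b, a)} := by
    ext ⟨c, d⟩
    simp only [mem_filter, mem_offDiag, Sym2.eq_iff, mem_insert, mem_singleton, Prod.mk.injEq]
    constructor
    · rintro ⟨_, h⟩; exact h
    · rintro (⟨rfl, rfl⟩ | ⟨rfl, rfl⟩)
      · exact ⟨⟨ha, hb, hab⟩, Or.inl ⟨rfl, rfl⟩⟩
      · exact ⟨⟨hb, ha, fun h => hab h.symm⟩, Or.inr ⟨rfl, rfl⟩⟩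
  rw [h, Finset.sum_pair (by intro h; exact hab (by simpa using (Prod.mk.inj h).1))]
  simp only [Sym2.lift_mk]
  rw [Finset.inter_comm b a]
  ring

theorem dg_sum (F : Finset (Finset ℕ)) (T : Finset ℕ) :
    ∑ x ∈ T, dg F x = ∑ A ∈ F, (A ∩ T).card := by
  have h1 : ∀ A ∈ F, (A ∩ T).card = ∑ x ∈ T, if x ∈ A then 1 else 0 := by
    intro A _
    rw [← Finset.card_filter]
    congr 1
    ext x
    simp [and_comm]
  rw [Finset.sum_congr rfl h1, Finset.sum_comm]
  simp [dg]

theorem dg_sq_sum (F : Finset (Finset ℕ)) (S : Finset ℕ) (hF : ∀ A ∈ F, A ⊆ S) :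
    ∑ x ∈ S, dg F x ^ 2 = 2 * omegaF F + ∑ A ∈ F, A.card := by
  have h1 : 2 * omegaF F + ∑ A ∈ F, A.card = ∑ p ∈ F ×ˢ F, (p.1 ∩ p.2).card := by
    rw [omega_two, ← Finset.diag_union_offDiag, Finset.sum_union (Finset.disjoint_diag_offDiag _),
      Finset.sum_diag, add_comm]
    simp
  have h2 : ∀ p ∈ F ×ˢ F, (p.1 ∩ p.2).card
      = ∑ x ∈ S, if x ∈ p.1 ∧ x ∈ p.2 then 1 else 0 := by
    intro p hp
    rw [← Finset.card_filter]
    congr 1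
    ext x
    have := hF p.1 (Finset.mem_product.1 hp).1
    simp only [mem_inter, mem_filter]
    exact ⟨fun h => ⟨this h.1, h⟩, fun h => h.2⟩
  rw [h1, Finset.sum_congr rfl h2, Finset.sum_comm]
  refine Finset.sum_congr rfl ?_
  intro x _
  rw [← Finset.card_filter, sq, dg, ← Finset.card_product]
  congr 1
  ext p
  simp only [mem_product, mem_filter]
  tauto

theorem codeg_le (n j : ℕ) (F : Finset (Finset ℕ))
    (hF : F ⊆ (Finset.Icc 1 n).powersetCard (j + 2)) (x y : ℕ) (hxy : x ≠ y) :
    (F.filter (fun A => x ∈ A ∧ y ∈ A)).card ≤ (n - 2).choose j := by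
  by_cases hx : x ∈ Finset.Icc 1 n ∧ y ∈ Finset.Icc 1 n
  swap
  · have : F.filter (fun A => x ∈ A ∧ y ∈ A) = ∅ := by
      refine Finset.filter_eq_empty_iff.2 ?_
      intro A hA h
      have := (Finset.mem_powersetCard.1 (hF hA)).1
      exact hx ⟨this h.1, this h.2⟩
    simp [this]
  have hc : ((Finset.Icc 1 n) \ {x, y}).card = n - 2 := by
    rw [Finset.card_sdiff_of_subset, Finset.card_pair hxy]
    · simp
    · intro z hz
      simp only [mem_insert, mem_singleton] at hz
      rcases hz with rfl | rfl
      exacts [hx.1, hx.2]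
  rw [← hc, ← Finset.card_powersetCard]
  refine Finset.card_le_card_of_injOn (fun A => A \ {x, y}) ?_ ?_
  · intro A hA
    have hA := Finset.mem_filter.1 hA
    obtain ⟨hs, hcard⟩ := Finset.mem_powersetCard.1 (hF hA.1)
    have hsub : ({x, y} : Finset ℕ) ⊆ A := by
      intro z hz
      simp only [mem_insert, mem_singleton] at hz
      rcases hz with rfl | rfl
      exacts [hA.2.1, hA.2.2]
    refine Finset.mem_coe.2 (Finset.mem_powersetCard.2 ⟨Finset.sdiff_subset_sdiff hs (le_refl _), ?_⟩)
    rw [Finset.card_sdiff_of_subset hsub, Finset.card_pair hxy, hcard]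
    omega
  · intro A hA B hB h
    have hA := Finset.mem_filter.1 hA
    have hB := Finset.mem_filter.1 hB
    ext z
    have := congrArg (fun S => z ∈ S) h
    simp only [mem_sdiff, mem_insert, mem_singleton, eq_iff_iff] at this
    by_cases h1 : z = x
    · subst h1; simp [hA.2, hB.2]
    by_cases h2 : z = y
    · subst h2; simp [hA.2, hB.2]
    simpa [h1, h2] using this

theorem bonf (n j : ℕ) (F : Finset (Finset ℕ))
    (hF : F ⊆ (Finset.Icc 1 n).powersetCard (j + 2)) (T : Finset ℕ) :
    2 * ∑ x ∈ T, dg F x ≤ 2 * F.card + T.card ^ 2 * (n - 2).choose j := by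
  have h1 : ∑ A ∈ F, (A ∩ T).offDiag.card ≤ T.card ^ 2 * (n - 2).choose j := by
    have h2 : ∀ A ∈ F, (A ∩ T).offDiag.card
        = ∑ p ∈ T.offDiag, if p.1 ∈ A ∧ p.2 ∈ A then 1 else 0 := by
      intro A _
      rw [← Finset.card_filter]
      congr 1
      ext p
      simp only [mem_offDiag, mem_inter, mem_filter]
      tauto
    rw [Finset.sum_congr rfl h2, Finset.sum_comm]
    calc _ ≤ ∑ p ∈ T.offDiag, (n - 2).choose j := by
            refine Finset.sum_le_sum ?_
            intro p hp
            rw [← Finset.card_filter]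
            exact codeg_le n j F hF _ _ (Finset.mem_offDiag.1 hp).2.2
      _ ≤ _ := by
            rw [Finset.sum_const, smul_eq_mul, Finset.offDiag_card]
            refine Nat.mul_le_mul_right _ ?_
            rw [sq]; omega
  have h3 : ∑ A ∈ F, 2 * (A ∩ T).card ≤ ∑ A ∈ F, (2 + (A ∩ T).offDiag.card) := by
    refine Finset.sum_le_sum ?_
    intro A _
    rw [Finset.offDiag_card]
    generalize (A ∩ T).card = a
    rcases a with _ | _ | a
    · simp
    · simp
    · have : (a + 1 + 1) * (a + 1 + 1) - (a + 1 + 1) = (a + 2) * (a + 1) := by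
        rw [Nat.sub_eq_iff_eq_add (by nlinarith)]; ring
      rw [this]; nlinarith
  rw [dg_sum, Finset.mul_sum]
  rw [Finset.sum_add_distrib, Finset.sum_const, smul_eq_mul] at h3
  omega

theorem choose_one_step (n j s : ℕ) (h : s + 2 ≤ n) :
    (n - 1).choose (j + 1) ≤ (n - 1 - s).choose (j + 1) + s * (n - 2).choose j := by
  induction s with
  | zero => simp
  | succ s ih =>
    have ih := ih (by omega)
    have e : n - 1 - s = (n - 1 - (s + 1)) + 1 := by omega
    rw [e, Nat.choose_succ_succ] at ih
    have : (n - 1 - (s + 1)).choose j ≤ (n - 2).choose j := Nat.choose_le_choose _ (by omega)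
    nlinarith

theorem choose_two_step (n j s : ℕ) (h : s + 2 ≤ n) :
    (n - s).choose (j + 2) + s * (n - 1).choose (j + 1)
      ≤ n.choose (j + 2) + s ^ 2 * (n - 2).choose j := by
  induction s with
  | zero => simp
  | succ s ih =>
    have ih := ih (by omega)
    have e : n - s = (n - (s + 1)) + 1 := by omega
    rw [e, Nat.choose_succ_succ] at ih
    have h1 := choose_one_step n j s (by omega)
    have e2 : n - 1 - s = n - (s + 1) := by omega
    rw [e2] at h1
    have : (s + 1) ^ 2 * (n - 2).choose j
      = s ^ 2 * (n - 2).choose j + s * (n - 2).choose j + (s + 1) * (n - 2).choose j := by ring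
    have : 0 ≤ (s + 1) * (n - 2).choose j := Nat.zero_le _
    have e3 : j + 1 + 1 = j + 2 := rfl
    rw [Nat.succ_eq_add_one, e3] at ih
    rw [add_mul, one_mul]
    omega

theorem exists_big (n k r m : ℕ) (hrn : r ≤ n) (hm2 : m ≤ n.choose k - (n - r).choose k) :
    ∃ G ⊆ (Finset.Icc 1 n).powersetCard k, G.card = m ∧
      m ^ 2 ≤ r * ∑ x ∈ Finset.Icc 1 n, dg G x ^ 2 := by
  have hsub : (Finset.Icc (r + 1) n).powersetCard k ⊆ (Finset.Icc 1 n).powersetCard k :=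
    Finset.powersetCard_mono (Finset.Icc_subset_Icc (by omega) le_rfl)
  have hc : ((Finset.Icc 1 n).powersetCard k \ (Finset.Icc (r + 1) n).powersetCard k).card
      = n.choose k - (n - r).choose k := by
    rw [Finset.card_sdiff_of_subset hsub]
    simp
  obtain ⟨G, hG, hGc⟩ := Finset.exists_subset_card_eq (hm2.trans hc.ge)
  refine ⟨G, hG.trans Finset.sdiff_subset, hGc, ?_⟩
  have h1 : m ≤ ∑ x ∈ Finset.Icc 1 r, dg G x := by
    rw [dg_sum, ← hGc, Finset.card_eq_sum_ones]
    refine Finset.sum_le_sum ?_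
    intro A hA
    obtain ⟨ha, hb⟩ := Finset.mem_sdiff.1 (hG hA)
    obtain ⟨hs, hcard⟩ := Finset.mem_powersetCard.1 ha
    rw [Nat.one_le_iff_ne_zero, Ne, Finset.card_eq_zero]
    intro he
    refine hb (Finset.mem_powersetCard.2 ⟨?_, hcard⟩)
    intro x hx
    have h1 := Finset.mem_Icc.1 (hs hx)
    refine Finset.mem_Icc.2 ⟨?_, h1.2⟩
    by_contra hlt
    have : x ∈ A ∩ Finset.Icc 1 r := Finset.mem_inter.2 ⟨hx, Finset.mem_Icc.2 ⟨h1.1, by omega⟩⟩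
    rw [he] at this
    simp at this
  have h2 : (∑ x ∈ Finset.Icc 1 r, dg G x) ^ 2 ≤ r * ∑ x ∈ Finset.Icc 1 r, dg G x ^ 2 := by
    simpa using sq_sum_le_card_mul_sum_sq (s := Finset.Icc 1 r) (f := dg G)
  have h3 : ∑ x ∈ Finset.Icc 1 r, dg G x ^ 2 ≤ ∑ x ∈ Finset.Icc 1 n, dg G x ^ 2 :=
    Finset.sum_le_sum_of_subset (Finset.Icc_subset_Icc le_rfl hrn)
  calc m ^ 2 ≤ (∑ x ∈ Finset.Icc 1 r, dg G x) ^ 2 := Nat.pow_le_pow_left h1 2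
    _ ≤ _ := h2
    _ ≤ _ := Nat.mul_le_mul_left _ h3

theorem numeric (n j r m : ℕ) (hr : 2 ≤ r)
    (hbig : 36 * (j + 2) * (2 * (j + 2) + 1) * ((j + 2) + r) * r < n)
    (hm1 : n.choose (j + 2) - (n - r + 1).choose (j + 2) < m) :
    (6 * (j + 2) * r) ^ 2 * (n - 2).choose j < 2 * m := by
  have hrn : r + 2 ≤ n := by nlinarith [Nat.zero_le (j * r), Nat.zero_le (j*j*r), Nat.zero_le (j*j*j*r), Nat.zero_le (j*r*r), Nat.zero_le (j*j*r*r)]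
  have h1 := choose_two_step n j (r - 1) (by omega)
  have e : n - (r - 1) = n - r + 1 := by omega
  rw [e] at h1
  have h2 : (n - 1) * (n - 2).choose j = (n - 1).choose (j + 1) * (j + 1) := by
    have := Nat.add_one_mul_choose_eq (n - 2) j
    rwa [show n - 2 + 1 = n - 1 by omega] at this
  obtain ⟨s, rfl⟩ : ∃ s, r = s + 1 := ⟨r - 1, by omega⟩
  obtain ⟨N, rfl⟩ : ∃ N, n = N + 1 := ⟨n - 1, by omega⟩
  have hE : 0 < (N + 1 - 2).choose j := by
    apply Nat.choose_pos
    have : (j + 2) * 1 ≤ (j + 2) * (36 * ((2 * (j + 2) + 1) * ((j + 2) + (s + 1)) * (s + 1))) :=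
      Nat.mul_le_mul_left _ (Nat.one_le_iff_ne_zero.2 (by positivity))
    have : j + 2 < N + 1 := by nlinarith
    omega
  simp only [Nat.add_sub_cancel] at *
  generalize (N + 1 - 2).choose j = E at *
  generalize N.choose (j + 1) = D at *
  have hm : s * D < m + s ^ 2 * E := by omega
  have hD : 36 * (2 * (j + 2) + 1) * ((j + 2) + (s + 1)) * (s + 1) * E ≤ D := by
    have : (36 * (2 * (j + 2) + 1) * ((j + 2) + (s + 1)) * (s + 1) * E) * (j + 1)
        ≤ D * (j + 1) := by
      rw [← h2]
      have : (36 * (2 * (j + 2) + 1) * ((j + 2) + (s + 1)) * (s + 1)) * (j + 1) ≤ N := by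
        nlinarith [Nat.zero_le (36 * (2 * (j + 2) + 1) * ((j + 2) + (s + 1)) * (s + 1))]
      calc _ = ((36 * (2 * (j + 2) + 1) * ((j + 2) + (s + 1)) * (s + 1)) * (j + 1)) * E := by ring
        _ ≤ _ := Nat.mul_le_mul_right _ this
    exact Nat.le_of_mul_le_mul_right this (by omega)
  have hs : 1 ≤ s := by omega
  have key : (6 * (j + 2) * (s + 1)) ^ 2 + 2 * s ^ 2
      ≤ 2 * s * (36 * (2 * (j + 2) + 1) * ((j + 2) + (s + 1)) * (s + 1)) := by
    have h7 : (s + 1) ≤ 2 * s := by omega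
    have h8 : (j + 2) ^ 2 + 1 ≤ (2 * (j + 2) + 1) * ((j + 2) + (s + 1)) := by nlinarith
    have h9 := Nat.mul_le_mul_left (36 * (s + 1) * (s + 1)) h8
    calc (6 * (j + 2) * (s + 1)) ^ 2 + 2 * s ^ 2
        ≤ 36 * (s + 1) * (s + 1) * ((j + 2) ^ 2 + 1) := by nlinarith
      _ ≤ _ := h9
      _ = (s + 1) * (36 * (2 * (j + 2) + 1) * ((j + 2) + (s + 1)) * (s + 1)) := by ring
      _ ≤ _ := Nat.mul_le_mul_right _ h7
  have h5 := Nat.mul_le_mul_right E key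
  have h6 := Nat.mul_le_mul_left (2 * s) hD
  nlinarith

theorem extremal_has_high_degree_vertex
    (n k r m : ℕ) (hr : 2 ≤ r) (hk : 0 < k) (hn : 0 < n) (hm : 0 < m)
    (hbig : 36 * k * (2 * k + 1) * (k + r) * r < n)
    (hm1 : n.choose k - (n - r + 1).choose k < m)
    (hm2 : m ≤ n.choose k - (n - r).choose k)
    (F : Finset (Finset ℕ)) (hFsub : F ⊆ (Finset.Icc 1 n).powersetCard k)
    (hFcard : F.card = m)
    (hext : ∀ F' ⊆ (Finset.Icc 1 n).powersetCard k, F'.card = m → omegaF F' ≤ omegaF F) :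
    ∃ x ∈ Finset.Icc 1 n,
      (m : ℚ) / (3 * (r : ℚ)) < ((F.filter (fun A => x ∈ A)).card : ℚ) := by
  by_contra hcon
  push Not at hcon
  have hr0 : (0 : ℚ) < 3 * (r : ℚ) := by positivity
  have hd : ∀ x ∈ Finset.Icc 1 n, 3 * r * dg F x ≤ m := by
    intro x hx
    have h := hcon x hx
    rw [le_div_iff₀ hr0] at h
    have h' : dg F x * (3 * r) ≤ m := by unfold dg; exact_mod_cast h
    linarith
  have hFS : ∀ A ∈ F, A ⊆ Finset.Icc 1 n := fun A hA => (Finset.mem_powersetCard.1 (hFsub hA)).1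
  have hFk : ∀ A ∈ F, A.card = k := fun A hA => (Finset.mem_powersetCard.1 (hFsub hA)).2
  have hrn : r ≤ n := by
    refine le_trans ?_ hbig.le
    exact Nat.le_mul_of_pos_left _ (by positivity)
  have hsumd : ∑ x ∈ Finset.Icc 1 n, dg F x = k * m := by
    rw [dg_sum, Finset.sum_congr rfl (fun A hA => by
      rw [Finset.inter_eq_left.2 (hFS A hA), hFk A hA]), Finset.sum_const, smul_eq_mul, hFcard,
      mul_comm]
  rcases k with _ | _ | j
  · omega
  · -- `k = 1`
    have hmr : m ≤ r := by
      simp only [zero_add, Nat.choose_one_right] at hm2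
      omega
    have hz : ∀ x ∈ Finset.Icc 1 n, dg F x = 0 := by
      intro x hx
      have := hd x hx
      by_contra h
      have : 1 ≤ dg F x := Nat.one_le_iff_ne_zero.2 h
      nlinarith
    rw [Finset.sum_eq_zero hz] at hsumd
    omega
  have hnum := numeric n j r m hr hbig hm1
  -- lower bound
  have hlow : m ^ 2 ≤ r * ∑ x ∈ Finset.Icc 1 n, dg F x ^ 2 := by
    obtain ⟨G, hG, hGc, hGb⟩ := exists_big n (j + 2) r m hrn hm2
    refine hGb.trans (Nat.mul_le_mul_left _ ?_)
    rw [dg_sq_sum F _ hFS, dg_sq_sum G _ (fun A hA => (Finset.mem_powersetCard.1 (hG hA)).1),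
      Finset.sum_congr rfl hFk,
      Finset.sum_congr rfl (fun A hA => (Finset.mem_powersetCard.1 (hG hA)).2),
      Finset.sum_const, Finset.sum_const, hGc, hFcard]
    exact Nat.add_le_add_right (Nat.mul_le_mul_left 2 (hext G hG hGc)) _
  -- small sets have small degree sum
  have hsmall : ∀ T : Finset ℕ, T.card ≤ 6 * (j + 2) * r → ∑ x ∈ T, dg F x < 2 * m := by
    intro T hT
    have h1 := bonf n j F hFsub T
    have h2 : T.card ^ 2 * (n - 2).choose j ≤ (6 * (j + 2) * r) ^ 2 * (n - 2).choose j :=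
      Nat.mul_le_mul_right _ (Nat.pow_le_pow_left hT 2)
    rw [hFcard] at h1
    omega
  set T := (Finset.Icc 1 n).filter (fun x => m ≤ 3 * (j + 2) * r * dg F x) with hTdef
  have hTcard : T.card ≤ 6 * (j + 2) * r := by
    by_contra hlt
    push Not at hlt
    obtain ⟨T', hT', hT'c⟩ := Finset.exists_subset_card_eq hlt.le
    have h1 := hsmall T' hT'c.le
    have h2 : ∑ x ∈ T', m ≤ ∑ x ∈ T', 3 * (j + 2) * r * dg F x :=
      Finset.sum_le_sum (fun x hx => (Finset.mem_filter.1 (hT' hx)).2)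
    rw [Finset.sum_const, smul_eq_mul, hT'c, ← Finset.mul_sum] at h2
    have h3 : 0 < 3 * (j + 2) * r := by positivity
    have h4 := Nat.mul_lt_mul_of_pos_left h1 h3
    nlinarith
  have hTs := hsmall T hTcard
  have hT2 : 3 * r * ∑ x ∈ T, dg F x ^ 2 ≤ m * ∑ x ∈ T, dg F x := by
    rw [Finset.mul_sum, Finset.mul_sum]
    refine Finset.sum_le_sum ?_
    intro x hx
    have := Nat.mul_le_mul_right (dg F x) (hd x (Finset.mem_filter.1 hx).1)
    nlinarith
  have hN2 : 3 * (j + 2) * r * ∑ x ∈ (Finset.Icc 1 n).filter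
      (fun x => ¬ m ≤ 3 * (j + 2) * r * dg F x), dg F x ^ 2 ≤ m * ((j + 2) * m) := by
    have h1 : ∑ x ∈ (Finset.Icc 1 n).filter
      (fun x => ¬ m ≤ 3 * (j + 2) * r * dg F x), dg F x ≤ (j + 2) * m := by
      rw [← show _ = (j + 2) * m from hsumd]
      exact Finset.sum_le_sum_of_subset (Finset.filter_subset _ _)
    refine le_trans ?_ (Nat.mul_le_mul_left m h1)
    rw [Finset.mul_sum, Finset.mul_sum]
    refine Finset.sum_le_sum ?_
    intro x hx
    have h2 := (Finset.mem_filter.1 hx).2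
    have := Nat.mul_le_mul_right (dg F x) (not_le.1 h2).le
    nlinarith
  rw [← Finset.sum_filter_add_sum_filter_not (Finset.Icc 1 n)
    (fun x => m ≤ 3 * (j + 2) * r * dg F x)] at hlow
  rw [← hTdef] at hlow
  generalize ∑ x ∈ (Finset.Icc 1 n).filter
      (fun x => ¬ m ≤ 3 * (j + 2) * r * dg F x), dg F x ^ 2 = Q at *
  generalize ∑ x ∈ T, dg F x ^ 2 = P at *
  have hQ : 3 * r * Q ≤ m * m := by
    have : (j + 2) * (3 * r * Q) ≤ (j + 2) * (m * m) := by nlinarith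
    exact Nat.le_of_mul_le_mul_left this (by omega)
  have := Nat.mul_lt_mul_of_pos_left hTs hm
  nlinarith
end

section
/- Let n, k, r be positive integers with r ≤ n, let 𝓐 := {A ∈ ([n] choose k) : A ∩ [r] ≠ ∅}, and let 𝓖 ⊆ 𝓐. Then ω(𝓖, 𝓐) ≥ |𝓖| · (k·C(n−1,k−1) − (k−1)·C(n−r−1,k−1)), with equality if |G ∩ [r]| = 1 for every G ∈ 𝓖. -/
open Finset

theorem card_filter_mem_aux (S : Finset ℕ) (k x : ℕ) (hk : 0 < k) (hx : x ∈ S) :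
    ((S.powersetCard k).filter (fun A => x ∈ A)).card = (S.card - 1).choose (k - 1) := by
  rw [← Finset.card_erase_of_mem hx, ← Finset.card_powersetCard]
  refine Finset.card_bij' (fun A _ => A.erase x) (fun B _ => insert x B) ?_ ?_ ?_ ?_
  · intro A hA
    simp only [mem_filter, mem_powersetCard] at hA ⊢
    exact ⟨Finset.erase_subset_erase _ hA.1.1, by rw [card_erase_of_mem hA.2, hA.1.2]⟩
  · intro B hB
    simp only [mem_filter, mem_powersetCard] at hB ⊢
    have hxB : x ∉ B := fun h => by simpa using hB.1 h
    refine ⟨⟨?_, ?_⟩, mem_insert_self _ _⟩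
    · exact insert_subset hx (hB.1.trans (erase_subset _ _))
    · rw [card_insert_of_notMem hxB, hB.2]; omega
  · intro A hA
    simp only [mem_filter] at hA
    exact insert_erase hA.2
  · intro B hB
    simp only [mem_powersetCard] at hB
    have hxB : x ∉ B := fun h => by simpa using hB.1 h
    exact erase_insert hxB

theorem sum_inter_aux (S G : Finset ℕ) (k : ℕ) (hk : 0 < k) :
    ∑ A ∈ S.powersetCard k, (G ∩ A).card = (G ∩ S).card * (S.card - 1).choose (k - 1) := by
  have h1 : ∀ A ∈ S.powersetCard k, (G ∩ A).card = ∑ x ∈ G ∩ S, if x ∈ A then 1 else 0 := by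
    intro A hA
    rw [mem_powersetCard] at hA
    rw [← Finset.card_filter]
    congr 1
    ext x
    have := @hA.1 x
    simp only [mem_inter, mem_filter]
    tauto
  rw [Finset.sum_congr rfl h1, Finset.sum_comm, Finset.card_eq_sum_ones, Finset.sum_mul]
  refine Finset.sum_congr rfl fun x hx => ?_
  rw [← Finset.card_filter, card_filter_mem_aux S k x hk (mem_inter.1 hx).2, one_mul]

theorem omega_single_aux (n k r : ℕ) (hk : 0 < k) (hrn : r ≤ n) (G : Finset ℕ)
    (hG : G ⊆ Finset.Icc 1 n) (hGk : G.card = k) :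
    ((∑ A ∈ ((Finset.Icc 1 n).powersetCard k).filter
      (fun A => (A ∩ Finset.Icc 1 r).Nonempty), (G ∩ A).card : ℕ) : ℤ)
    = (k : ℤ) * (((n - 1).choose (k - 1) : ℕ) : ℤ)
      - ((k : ℤ) - ((G ∩ Finset.Icc 1 r).card : ℤ)) *
        (((n - r - 1).choose (k - 1) : ℕ) : ℤ) := by
  have h0 := sum_inter_aux (Finset.Icc 1 n) G k hk
  have h1 := sum_inter_aux (Finset.Icc (r + 1) n) G k hk
  rw [← Finset.sum_filter_add_sum_filter_not _ (fun A => (A ∩ Finset.Icc 1 r).Nonempty)] at h0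
  have h2 : ((Finset.Icc 1 n).powersetCard k).filter
      (fun A => ¬ (A ∩ Finset.Icc 1 r).Nonempty) = (Finset.Icc (r + 1) n).powersetCard k := by
    ext A
    simp only [mem_filter, mem_powersetCard, not_nonempty_iff_eq_empty, Finset.ext_iff,
      mem_inter, mem_Icc, subset_iff, notMem_empty, iff_false]
    constructor
    · rintro ⟨⟨ha, hc⟩, hb⟩
      refine ⟨fun x hx => ?_, hc⟩
      have := ha hx
      have := hb x
      have : ¬ (1 ≤ x ∧ x ≤ r) := fun h => this ⟨hx, h⟩
      omega
    · rintro ⟨ha, hc⟩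
      refine ⟨⟨fun x hx => ?_, hc⟩, fun x hx => ?_⟩
      · have := ha hx
        omega
      · have := ha hx.1
        omega
  have h3 : (G ∩ Finset.Icc 1 r).card + (G ∩ Finset.Icc (r + 1) n).card = k := by
    rw [← hGk, ← Finset.card_union_of_disjoint]
    · congr 1
      ext x
      have := @hG x
      simp only [mem_union, mem_inter, mem_Icc] at this ⊢
      constructor
      · tauto
      · intro hx
        have := this hx
        by_cases x ≤ r
        · left; exact ⟨hx, by omega⟩
        · right; exact ⟨hx, by omega⟩
    · rw [Finset.disjoint_left]
      intro x hx hy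
      simp only [mem_inter, mem_Icc] at hx hy
      omega
  rw [h2, h1, Finset.inter_eq_left.2 hG, hGk, Nat.card_Icc, Nat.card_Icc,
    show n + 1 - 1 - 1 = n - 1 by omega, show n + 1 - (r + 1) - 1 = n - r - 1 by omega] at h0
  zify at h0 h3
  rw [← h0, ← h3]
  push_cast
  ring

theorem omegaPair_with_cover_family_lower_bound
    (n k r : ℕ) (hn : 0 < n) (hk : 0 < k) (hr : 0 < r) (hrn : r ≤ n)
    (Afam Gfam : Finset (Finset ℕ))
    (hA : Afam = ((Finset.Icc 1 n).powersetCard k).filter (fun A => (A ∩ Finset.Icc 1 r).Nonempty))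
    (hG : Gfam ⊆ Afam) :
    (Gfam.card : ℤ) * ((k : ℤ) * (((n - 1).choose (k - 1) : ℕ) : ℤ)
        - ((k : ℤ) - 1) * (((n - r - 1).choose (k - 1) : ℕ) : ℤ))
      ≤ (omegaPair Gfam Afam : ℤ) ∧
    ((∀ G ∈ Gfam, (G ∩ Finset.Icc 1 r).card = 1) →
      (omegaPair Gfam Afam : ℤ) = (Gfam.card : ℤ) * ((k : ℤ) * (((n - 1).choose (k - 1) : ℕ) : ℤ)
        - ((k : ℤ) - 1) * (((n - r - 1).choose (k - 1) : ℕ) : ℤ))) := by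
  have key : ∀ G ∈ Gfam, ((∑ A ∈ Afam, (G ∩ A).card : ℕ) : ℤ)
      = (k : ℤ) * (((n - 1).choose (k - 1) : ℕ) : ℤ)
        - ((k : ℤ) - ((G ∩ Finset.Icc 1 r).card : ℤ)) *
          (((n - r - 1).choose (k - 1) : ℕ) : ℤ) := by
    intro G hGm
    have := hG hGm
    rw [hA, mem_filter, mem_powersetCard] at this
    rw [hA]
    exact omega_single_aux n k r hk hrn G this.1.1 this.1.2
  unfold omegaPair
  rw [Nat.cast_sum, Finset.sum_congr rfl key, ← nsmul_eq_mul, ← Finset.sum_const]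
  constructor
  · refine Finset.sum_le_sum fun G hGm => ?_
    have := hG hGm
    rw [hA, mem_filter] at this
    have h1 : (1 : ℤ) ≤ ((G ∩ Finset.Icc 1 r).card : ℤ) := by
      exact_mod_cast this.2.card_pos
    gcongr
  · intro h
    refine Finset.sum_congr rfl fun G hGm => ?_
    rw [h G hGm, Nat.cast_one]
end

section
/- Let n, k, m be positive integers with k ≤ n and 1 ≤ m < C(n,k), and suppose C(n,k) − m = C(n−r_1,k) + C(n−r_2,k−1) + ⋯ + C(n−r_s,k−s+1) where 1 ≤ r_1 < r_2 < ⋯ < r_s ≤ n−1, s ≤ k, and n − r_i ≥ k−i+1 for each i (the k-cascade form of C(n,k)−m). Then the m-th set of ([n] choose k) in lexicographic order, i.e., the lexicographically largest member of L_{n,k}^m, equals {r_1, …, r_s} ∪ {n−k+s+1, n−k+s+2, …, n}. -/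
open Finset

theorem lexLT_iff_exists (A B : Finset ℕ) :
    lexLT A B ↔ ∃ x ∈ A, x ∉ B ∧ ∀ y < x, (y ∈ A ↔ y ∈ B) := by
  unfold lexLT
  constructor
  · intro h
    have hne : (A \ B).Nonempty := by
      by_contra hc
      rw [Finset.not_nonempty_iff_eq_empty] at hc
      rw [hc] at h
      simp at h
    obtain ⟨x, hx⟩ := Finset.min_of_nonempty hne
    have hxm := Finset.mem_of_min hx
    rw [Finset.mem_sdiff] at hxm
    refine ⟨x, hxm.1, hxm.2, fun y hy => ?_⟩
    rw [hx] at h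
    constructor
    · intro hyA
      by_contra hyB
      have h1 := Finset.min_le (Finset.mem_sdiff.2 ⟨hyA, hyB⟩)
      rw [hx] at h1
      have h2 : x ≤ y := by exact_mod_cast h1
      omega
    · intro hyB
      by_contra hyA
      have h1 := Finset.min_le (Finset.mem_sdiff.2 ⟨hyB, hyA⟩)
      have h2 := lt_of_lt_of_le h h1
      have h3 : x < y := by exact_mod_cast h2
      omega
  · rintro ⟨x, hxA, hxB, h⟩
    have h1 := Finset.min_le (Finset.mem_sdiff.2 ⟨hxA, hxB⟩)
    refine lt_of_le_of_lt h1 ?_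
    rcases (B \ A).eq_empty_or_nonempty with he | hne
    · rw [he]; simp
    · obtain ⟨z, hz⟩ := Finset.min_of_nonempty hne
      have hzm := Finset.mem_of_min hz
      rw [Finset.mem_sdiff] at hzm
      rw [hz]
      have : x < z := by
        rcases lt_trichotomy x z with h2 | h2 | h2
        · exact h2
        · subst h2; exact absurd hxA hzm.2
        · exact absurd ((h z h2).2 hzm.1) hzm.2
      exact_mod_cast this

theorem lexLT_trans' {A B C : Finset ℕ} (h1 : lexLT A B) (h2 : lexLT B C) : lexLT A C := by
  rw [lexLT_iff_exists] at *
  obtain ⟨x, hxA, hxB, hx⟩ := h1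
  obtain ⟨y, hyB, hyC, hy⟩ := h2
  rcases lt_trichotomy x y with h | h | h
  · exact ⟨x, hxA, fun hc => hxB ((hy x h).2 hc),
      fun z hz => (hx z hz).trans (hy z (by omega))⟩
  · subst h; exact absurd hyB hxB
  · exact ⟨y, (hx y h).2 hyB, hyC, fun z hz => (hx z (by omega)).trans (hy z hz)⟩

theorem lexLT_asymm' {A B : Finset ℕ} (h1 : lexLT A B) (h2 : lexLT B A) : False :=
  lt_asymm h1 h2

theorem lexLT_total' {A B : Finset ℕ} (h : A ≠ B) : lexLT A B ∨ lexLT B A := by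
  have hex : ∃ x, ¬ (x ∈ A ↔ x ∈ B) := by
    by_contra hc
    push Not at hc
    exact h (Finset.ext hc)
  classical
  have hs := Nat.find_spec hex
  have hmin : ∀ y < Nat.find hex, (y ∈ A ↔ y ∈ B) := fun y hy => by
    have := Nat.find_min hex hy
    exact not_not.1 this
  by_cases hA : Nat.find hex ∈ A
  · left
    rw [lexLT_iff_exists]
    exact ⟨_, hA, fun hB => hs ⟨fun _ => hB, fun _ => hA⟩, hmin⟩
  · right
    rw [lexLT_iff_exists]
    refine ⟨Nat.find hex, ?_, hA, fun y hy => (hmin y hy).symm⟩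
    by_contra hB
    exact hs ⟨fun h => absurd h hA, fun h => absurd h hB⟩

/-- Sets agreeing with `A` below `r`, missing `r`: counted by a binomial coefficient. -/
theorem card_branch (n k r j : ℕ) (A : Finset ℕ) (hr : 1 ≤ r) (hrn : r ≤ n)
    (hA : A ⊆ Finset.Icc 1 n) (hj : (A.filter (· < r)).card = j) (hjk : j ≤ k) :
    (((Finset.Icc 1 n).powersetCard k).filter
      (fun B => r ∉ B ∧ ∀ y < r, (y ∈ A ↔ y ∈ B))).card = (n - r).choose (k - j) := by
  have h0 : (n - r).choose (k - j) = ((Finset.Icc (r + 1) n).powersetCard (k - j)).card := by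
    rw [Finset.card_powersetCard, Nat.card_Icc]
    congr 1
    omega
  rw [h0]
  symm
  refine Finset.card_bij' (fun C _ => A.filter (· < r) ∪ C) (fun B _ => B.filter (r < ·))
    ?_ ?_ ?_ ?_
  · intro C hC
    rw [Finset.mem_powersetCard] at hC
    have hmem : ∀ y ∈ C, r < y ∧ y ≤ n := fun y hy => by
      have := Finset.mem_Icc.1 (hC.1 hy); omega
    rw [Finset.mem_filter, Finset.mem_powersetCard]
    refine ⟨⟨?_, ?_⟩, ?_, ?_⟩
    · intro y hy
      rcases Finset.mem_union.1 hy with h | h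
      · exact hA (Finset.mem_filter.1 h).1
      · have := hmem y h
        rw [Finset.mem_Icc]; omega
    · rw [Finset.card_union_of_disjoint, hj, hC.2]
      · omega
      · rw [Finset.disjoint_left]
        intro y hy hy'
        have h1 := (Finset.mem_filter.1 hy).2
        have h2 := hmem y hy'
        omega
    · intro h
      rcases Finset.mem_union.1 h with h | h
      · have := (Finset.mem_filter.1 h).2; omega
      · have := hmem r h; omega
    · intro y hy
      rw [Finset.mem_union, Finset.mem_filter]
      constructor
      · intro h; exact Or.inl ⟨h, hy⟩
      · rintro (h | h)
        · exact h.1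
        · have := hmem y h; omega
  · intro B hB
    rw [Finset.mem_filter, Finset.mem_powersetCard] at hB
    obtain ⟨⟨hB1, hB2⟩, hrB, hag⟩ := hB
    rw [Finset.mem_powersetCard]
    constructor
    · intro y hy
      rw [Finset.mem_filter] at hy
      have := Finset.mem_Icc.1 (hB1 hy.1)
      rw [Finset.mem_Icc]; omega
    · have h1 : A.filter (· < r) = B.filter (fun y => ¬ r < y) := by
        ext y
        rw [Finset.mem_filter, Finset.mem_filter]
        constructor
        · rintro ⟨h, h'⟩; exact ⟨(hag y h').1 h, by omega⟩
        · rintro ⟨h, h'⟩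
          have : y < r := by
            rcases Nat.lt_or_ge y r with h2 | h2
            · exact h2
            · have : y = r := by omega
              subst this; exact absurd h hrB
          exact ⟨(hag y this).2 h, this⟩
      have h2 := Finset.card_filter_add_card_filter_not (s := B) (fun y => r < y)
      rw [← h1, hj, hB2] at h2
      omega
  · intro C hC
    rw [Finset.mem_powersetCard] at hC
    ext y
    simp only [Finset.mem_filter, Finset.mem_union]
    constructor
    · rintro ⟨h | h, h'⟩
      · omega
      · exact h
    · intro h
      have := Finset.mem_Icc.1 (hC.1 h)
      exact ⟨Or.inr h, by omega⟩
  · intro B hB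
    rw [Finset.mem_filter] at hB
    obtain ⟨_, hrB, hag⟩ := hB
    ext y
    simp only [Finset.mem_filter, Finset.mem_union]
    constructor
    · rintro (h | h)
      · exact (hag y h.2).1 h.1
      · exact h.1
    · intro h
      rcases lt_trichotomy y r with h2 | h2 | h2
      · exact Or.inl ⟨(hag y h2).2 h, h2⟩
      · subst h2; exact absurd h hrB
      · exact Or.inr ⟨h, h2⟩

theorem last_set_of_initSeg
    (n k m : ℕ) (hk : 1 ≤ k) (hkn : k ≤ n) (hm : 1 ≤ m) (hm2 : m < n.choose k)
    (s : ℕ) (f : Fin (s + 1) → ℕ) (hsk : s + 1 ≤ k)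
    (hmono : StrictMono f) (hf1 : 1 ≤ f 0) (hfn : f (Fin.last s) ≤ n - 1)
    (hcas : ∀ i : Fin (s + 1), k - (i : ℕ) ≤ n - f i)
    (hsum : n.choose k - m = ∑ i : Fin (s + 1), (n - f i).choose (k - (i : ℕ)))
    (L : Finset (Finset ℕ)) (hL : IsInitSeg n k m L) :
    (Finset.univ.image f ∪ Finset.Icc (n - k + (s + 1) + 1) n) ∈ L ∧
    ∀ B ∈ L, B ≠ Finset.univ.image f ∪ Finset.Icc (n - k + (s + 1) + 1) n →
      lexLT B (Finset.univ.image f ∪ Finset.Icc (n - k + (s + 1) + 1) n) := by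
  classical
  obtain ⟨hLU, hLc, hLi⟩ := hL
  set A := Finset.univ.image f ∪ Finset.Icc (n - k + (s + 1) + 1) n with hAdef
  have hf1' : ∀ i, 1 ≤ f i := fun i => hf1.trans (hmono.monotone (Fin.zero_le i))
  have hfn' : ∀ i, f i ≤ n - 1 := fun i => (hmono.monotone (Fin.le_last i)).trans hfn
  have hflt : ∀ i, f i < n - k + (s + 1) + 1 := fun i => by
    have h1 := hcas i
    have h2 := i.2
    have h3 := hfn' i
    omega
  have hmemA : ∀ y, y ∈ A ↔ (∃ i, f i = y) ∨ (n - k + (s + 1) + 1 ≤ y ∧ y ≤ n) := by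
    intro y; simp [hAdef]
  have hAsub : A ⊆ Finset.Icc 1 n := by
    intro y hy
    rw [Finset.mem_Icc]
    rcases (hmemA y).1 hy with ⟨i, rfl⟩ | h
    · have := hf1' i; have := hfn' i; omega
    · omega
  have hAcard : A.card = k := by
    rw [hAdef, Finset.card_union_of_disjoint, Finset.card_image_of_injective _ hmono.injective,
      Nat.card_Icc, Finset.card_univ, Fintype.card_fin]
    · omega
    · rw [Finset.disjoint_left]
      intro y hy hy'
      obtain ⟨i, _, rfl⟩ := Finset.mem_image.1 hy
      have := hflt i
      have := Finset.mem_Icc.1 hy'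
      omega
  set U := (Finset.Icc 1 n).powersetCard k with hU
  have hAU : A ∈ U := Finset.mem_powersetCard.2 ⟨hAsub, hAcard⟩
  have hUc : U.card = n.choose k := by rw [hU, Finset.card_powersetCard, Nat.card_Icc]; simp
  have hbelow : ∀ i : Fin (s + 1), (A.filter (· < f i)).card = (i : ℕ) := by
    intro i
    have : A.filter (· < f i) = (Finset.Iio i).image f := by
      ext y
      rw [Finset.mem_filter, hmemA, Finset.mem_image]
      constructor
      · rintro ⟨⟨j, rfl⟩ | h, hlt⟩
        · exact ⟨j, Finset.mem_Iio.2 (hmono.lt_iff_lt.1 hlt), rfl⟩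
        · have := hflt i; omega
      · rintro ⟨j, hj, rfl⟩
        exact ⟨Or.inl ⟨j, rfl⟩, hmono (Finset.mem_Iio.1 hj)⟩
    rw [this, Finset.card_image_of_injective _ hmono.injective, Fin.card_Iio]
  have hG : U.filter (fun B => lexLT A B) = Finset.univ.biUnion (fun i : Fin (s + 1) =>
      U.filter (fun B => f i ∉ B ∧ ∀ y < f i, (y ∈ A ↔ y ∈ B))) := by
    ext B
    simp only [Finset.mem_filter, Finset.mem_biUnion, Finset.mem_univ, true_and]
    constructor
    · rintro ⟨hBU, hlt⟩
      rw [lexLT_iff_exists] at hlt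
      obtain ⟨x, hxA, hxB, hx⟩ := hlt
      rcases (hmemA x).1 hxA with ⟨i, rfl⟩ | h
      · exact ⟨i, hBU, hxB, hx⟩
      · exfalso
        obtain ⟨hB1, hB2⟩ := Finset.mem_powersetCard.1 hBU
        have hsub : B ⊆ A.erase x := by
          intro y hy
          have hyx : y ≠ x := by rintro rfl; exact hxB hy
          rw [Finset.mem_erase]
          refine ⟨hyx, ?_⟩
          rcases Nat.lt_or_ge y x with h2 | h2
          · exact (hx y h2).2 hy
          · have := Finset.mem_Icc.1 (hB1 hy)
            exact (hmemA y).2 (Or.inr (by omega))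
        have := Finset.card_le_card hsub
        rw [Finset.card_erase_of_mem hxA, hAcard, hB2] at this
        omega
    · rintro ⟨i, hBU, h1, h2⟩
      exact ⟨hBU, (lexLT_iff_exists A B).2 ⟨f i, (hmemA _).2 (Or.inl ⟨i, rfl⟩), h1, h2⟩⟩
  have hGc : (U.filter (fun B => lexLT A B)).card = n.choose k - m := by
    rw [hG, Finset.card_biUnion, hsum]
    · refine Finset.sum_congr rfl fun i _ => ?_
      have := i.2
      have := hfn' i
      exact card_branch n k (f i) i A (hf1' i) (by omega) hAsub (hbelow i) (by omega)
    · have key : ∀ i j : Fin (s + 1), i < j → ∀ B : Finset ℕ, f i ∉ B →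
          (∀ y < f j, (y ∈ A ↔ y ∈ B)) → False := fun i j hij B h1 h2 =>
        h1 ((h2 (f i) (hmono hij)).1 ((hmemA _).2 (Or.inl ⟨i, rfl⟩)))
      intro i _ j _ hij
      rw [Function.onFun, Finset.disjoint_left]
      intro B hB hB'
      rw [Finset.mem_filter] at hB hB'
      rcases lt_or_gt_of_ne hij with h | h
      · exact key i j h B hB.2.1 hB'.2.2
      · exact key j i h B hB'.2.1 hB.2.2
  have hHc : (U.filter (fun B => ¬ lexLT A B)).card = m := by
    have := Finset.card_filter_add_card_filter_not (s := U) (fun B => lexLT A B)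
    rw [hGc, hUc] at this
    omega
  have hLH : L = U.filter (fun B => ¬ lexLT A B) := by
    refine Finset.eq_of_subset_of_card_le ?_ (by rw [hHc, hLc])
    intro x hx
    by_contra hxH
    have hxU := hLU hx
    have hAx : lexLT A x := by
      by_contra hc
      exact hxH (Finset.mem_filter.2 ⟨hxU, hc⟩)
    have hnot : ¬ (U.filter (fun B => ¬ lexLT A B)) ⊆ L := by
      intro hsub
      have := Finset.eq_of_subset_of_card_le hsub (by rw [hHc, hLc])
      exact hxH (this ▸ hx)
    obtain ⟨y, hyH, hyL⟩ := Finset.not_subset.1 hnot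
    rw [Finset.mem_filter] at hyH
    have hxy := hLi x hx y hyH.1 hyL
    exact hyH.2 (lexLT_trans' hAx hxy)
  rw [hLH]
  refine ⟨Finset.mem_filter.2 ⟨hAU, fun h => lexLT_asymm' h h⟩, fun B hB hne => ?_⟩
  exact (lexLT_total' hne).resolve_right (Finset.mem_filter.1 hB).2
end
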